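/- arXiv:2511.02820 — 9 statements merged into one kernel-verified Lean document; each statement's English description precedes it below -/
import Mathlib

section
/- Let n ≥ 1, let P : Fin n → Finset (Fin n) satisfy i ∈ P i for every i and P j ⊆ P i whenever j ∈ P i, let F : ℝ → ℝ, let w c : Fin n → ℝ with w i ≥ 0 and c i ≥ 0 for all i, and let B : ℝ. Suppose x : Fin n → ℝ satisfies 0 ≤ x i ≤ 1 for all i and ∑ i, c i * x i ≤ B. Define x' i to be the minimum of x over the nonempty finite set P i. Then: (i) 0 ≤ x' i ≤ x i ≤ 1 for all i and ∑ i, c i * x' i ≤ B; (ii) x' i ≥ x' j whenever i ∈ P j; (iii) for every i, the minimum of x' over P i equals the minimum of x over P i, and consequently ∑ i, w i * (1 − F (min_{j ∈ P i} x' j)) = ∑ i, w i * (1 − F (min_{j ∈ P i} x j)). In particular, every feasible fortification plan can be replaced by a feasible plan with the same objective value in which fortification levels are nonincreasing along every path from the source. -/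
/-- Replacing each fortification level by the minimum along the path
from the source yields a feasible plan that is nonincreasing along paths and has the
same objective value. -/
theorem path_min_replacement
    (n : ℕ) (hn : 1 ≤ n) (P : Fin n → Finset (Fin n))
    (hPself : ∀ i, i ∈ P i) (hPnested : ∀ i j, j ∈ P i → P j ⊆ P i)
    (F : ℝ → ℝ) (w c : Fin n → ℝ) (hw : ∀ i, 0 ≤ w i) (hc : ∀ i, 0 ≤ c i)
    (B : ℝ) (x : Fin n → ℝ)
    (hx0 : ∀ i, 0 ≤ x i) (hx1 : ∀ i, x i ≤ 1)
    (hxB : ∑ i, c i * x i ≤ B) :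
    let x' : Fin n → ℝ := fun i => (P i).inf' ⟨i, hPself i⟩ x
    (∀ i, 0 ≤ x' i ∧ x' i ≤ x i ∧ x i ≤ 1) ∧
    (∑ i, c i * x' i ≤ B) ∧
    (∀ i j, i ∈ P j → x' j ≤ x' i) ∧
    (∀ i, (P i).inf' ⟨i, hPself i⟩ x' = (P i).inf' ⟨i, hPself i⟩ x) ∧
    (∑ i, w i * (1 - F ((P i).inf' ⟨i, hPself i⟩ x')) =
      ∑ i, w i * (1 - F ((P i).inf' ⟨i, hPself i⟩ x))) := by
  intro x'
  have hle : ∀ i, x' i ≤ x i := fun i => Finset.inf'_le x (hPself i)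
  have hmono : ∀ i j, i ∈ P j → x' j ≤ x' i := fun i j hij =>
    Finset.le_inf' _ _ fun k hk => Finset.inf'_le x (hPnested j i hij hk)
  have hmin : ∀ i, (P i).inf' ⟨i, hPself i⟩ x' = (P i).inf' ⟨i, hPself i⟩ x := fun i =>
    le_antisymm (Finset.inf'_le x' (hPself i))
      (Finset.le_inf' _ _ fun k hk => hmono k i hk)
  refine ⟨fun i => ⟨Finset.le_inf' _ _ fun k _ => hx0 k, hle i, hx1 i⟩, ?_, hmono, hmin, ?_⟩
  · exact (Finset.sum_le_sum fun i _ => mul_le_mul_of_nonneg_left (hle i) (hc i)).trans hxB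
  · exact Finset.sum_congr rfl fun i _ => by rw [hmin i]
end

section
/- Let n ≥ 1, let P : Fin n → Finset (Fin n) satisfy i ∈ P i for every i and P j ⊆ P i whenever j ∈ P i, let F : ℝ → ℝ, let w c : Fin n → ℝ with w i ≥ 0 and c i ≥ 0 for all i, and let B : ℝ. Then for every feasible fortification plan x there exists a feasible fortification plan x' with the same objective value, ∑ i, w i * (1 − F (min_{j ∈ P i} x' j)) = ∑ i, w i * (1 − F (min_{j ∈ P i} x j)), such that x' i ≥ x' j whenever i ∈ P j, and in particular such that for all i and j with i ∈ P j, x' i = 0 implies x' j = 0 (if a node's fortification level is zero, so is that of every node it precedes). -/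
/-- Every feasible fortification plan can be replaced by a feasible plan
with the same objective value whose fortification levels are nonincreasing along every
path from the source; in particular, if a node's level is zero, so is that of every node
it precedes. -/
theorem exists_monotone_plan_same_objective
    (n : ℕ) (hn : 1 ≤ n) (P : Fin n → Finset (Fin n))
    (hPself : ∀ i, i ∈ P i) (hPnested : ∀ i j, j ∈ P i → P j ⊆ P i)
    (F : ℝ → ℝ) (w c : Fin n → ℝ) (hw : ∀ i, 0 ≤ w i) (hc : ∀ i, 0 ≤ c i)
    (B : ℝ) (x : Fin n → ℝ)
    (hx0 : ∀ i, 0 ≤ x i) (hx1 : ∀ i, x i ≤ 1)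
    (hxB : ∑ i, c i * x i ≤ B) :
    ∃ x' : Fin n → ℝ,
      (∀ i, 0 ≤ x' i ∧ x' i ≤ 1) ∧
      (∑ i, c i * x' i ≤ B) ∧
      (∑ i, w i * (1 - F ((P i).inf' ⟨i, hPself i⟩ x')) =
        ∑ i, w i * (1 - F ((P i).inf' ⟨i, hPself i⟩ x))) ∧
      (∀ i j, i ∈ P j → x' j ≤ x' i) ∧
      (∀ i j, i ∈ P j → x' i = 0 → x' j = 0) := by
  -- replace each level by the minimum level along the path
  have hle : ∀ i, (P i).inf' ⟨i, hPself i⟩ x ≤ x i := fun i => Finset.inf'_le x (hPself i)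
  have h0 : ∀ i, 0 ≤ (P i).inf' ⟨i, hPself i⟩ x := fun i =>
    Finset.le_inf' _ _ (fun j _ => hx0 j)
  have hmono : ∀ i j, i ∈ P j →
      (P j).inf' ⟨j, hPself j⟩ x ≤ (P i).inf' ⟨i, hPself i⟩ x := fun i j hij =>
    Finset.le_inf' _ _ (fun k hk => Finset.inf'_le x (hPnested j i hij hk))
  refine ⟨fun i => (P i).inf' ⟨i, hPself i⟩ x, fun i => ⟨h0 i, (hle i).trans (hx1 i)⟩,
    ?_, ?_, hmono, ?_⟩
  · exact (Finset.sum_le_sum fun i _ => mul_le_mul_of_nonneg_left (hle i) (hc i)).trans hxB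
  · refine Finset.sum_congr rfl fun i _ => ?_
    have h : (P i).inf' ⟨i, hPself i⟩ (fun k => (P k).inf' ⟨k, hPself k⟩ x)
        = (P i).inf' ⟨i, hPself i⟩ x :=
      le_antisymm (Finset.inf'_le (fun k => (P k).inf' ⟨k, hPself k⟩ x) (hPself i))
        (Finset.le_inf' _ _ (fun k hk => hmono k i hk))
    rw [h]
  · intro i j hij hi
    exact le_antisymm ((hmono i j hij).trans (le_of_eq hi)) (h0 j)
end

section
/- Assume F : ℝ → ℝ satisfies F 0 = 0, F 1 = 1, and F y ≤ y for all y ∈ [0,1], and let w : Fin n → ℝ with w i > 0 for all i and B : ℝ. If there exists a subset S ⊆ Fin n with ∑_{i ∈ S} w i = B, then the indicator plan x with x i = 1 for i ∈ S and x i = 0 otherwise is feasible for [KP_S] and achieves objective value ∑ i, w i * F (x i) = B; moreover every feasible x satisfies ∑ i, w i * F (x i) ≤ B, so the optimal value of [KP_S] equals B. -/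
/-- If a subset `S` of items has total weight exactly `B`, then the
indicator plan of `S` is feasible for `[KP_S]` and achieves objective value `B`, and
every feasible plan has objective value at most `B`; hence the optimal value of
`[KP_S]` equals `B`. -/
theorem subset_sum_gives_optimal_value
    (n : ℕ) (F : ℝ → ℝ) (hF0 : F 0 = 0) (hF1 : F 1 = 1)
    (hFle : ∀ y ∈ Set.Icc (0 : ℝ) 1, F y ≤ y)
    (w : Fin n → ℝ) (hw : ∀ i, 0 < w i) (B : ℝ)
    (S : Finset (Fin n)) (hS : ∑ i ∈ S, w i = B) :
    (∀ i : Fin n, 0 ≤ (if i ∈ S then (1 : ℝ) else 0) ∧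
        (if i ∈ S then (1 : ℝ) else 0) ≤ 1) ∧
    (∑ i, w i * (if i ∈ S then (1 : ℝ) else 0) ≤ B) ∧
    (∑ i, w i * F (if i ∈ S then (1 : ℝ) else 0) = B) ∧
    (∀ x : Fin n → ℝ, (∀ i, 0 ≤ x i ∧ x i ≤ 1) → ∑ i, w i * x i ≤ B →
      ∑ i, w i * F (x i) ≤ B) := by
  refine ⟨fun i => ?_, ?_, ?_, fun x hx hB => ?_⟩
  · split_ifs <;> norm_num
  · simp [hS]
  · simp [apply_ite F, hF0, hF1, hS]
  · refine le_trans (Finset.sum_le_sum fun i _ => ?_) hB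
    exact mul_le_mul_of_nonneg_left (hFle _ ⟨(hx i).1, (hx i).2⟩) (hw i).le
end

section
/- Assume F : ℝ → ℝ satisfies F 0 = 0, F 1 = 1, F y ≤ y for all y ∈ [0,1], and F y < y for all y ∈ (0,1), and let w : Fin n → ℝ with w i > 0 for all i and B : ℝ. If x : Fin n → ℝ is feasible for [KP_S] (0 ≤ x i ≤ 1 for all i and ∑ i, w i * x i ≤ B) and attains ∑ i, w i * F (x i) = B, then x i ∈ {0, 1} for every i, ∑ i, w i * x i = B, and the set S = {i : x i = 1} satisfies ∑_{i ∈ S} w i = B; hence a subset-sum solution exists. -/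
/-- If `F` lies strictly below the diagonal on `(0,1)` and a feasible
plan for `[KP_S]` attains objective value `B`, then the plan is 0/1-valued, spends the
budget exactly, and the set of fully fortified items is a subset-sum solution. -/
theorem optimal_value_gives_subset_sum
    (n : ℕ) (F : ℝ → ℝ) (hF0 : F 0 = 0) (hF1 : F 1 = 1)
    (hFle : ∀ y ∈ Set.Icc (0 : ℝ) 1, F y ≤ y)
    (hFlt : ∀ y ∈ Set.Ioo (0 : ℝ) 1, F y < y)
    (w : Fin n → ℝ) (hw : ∀ i, 0 < w i) (B : ℝ)
    (x : Fin n → ℝ) (hx : ∀ i, 0 ≤ x i ∧ x i ≤ 1)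
    (hxB : ∑ i, w i * x i ≤ B)
    (hobj : ∑ i, w i * F (x i) = B) :
    (∀ i, x i = 0 ∨ x i = 1) ∧
    (∑ i, w i * x i = B) ∧
    (∃ S : Finset (Fin n), (∀ i, i ∈ S ↔ x i = 1) ∧ ∑ i ∈ S, w i = B) := by
  have hle : ∀ i ∈ Finset.univ, w i * F (x i) ≤ w i * x i := fun i _ =>
    mul_le_mul_of_nonneg_left (hFle _ ⟨(hx i).1, (hx i).2⟩) (hw i).le
  have hsum : ∑ i, w i * x i = B :=
    le_antisymm hxB (hobj ▸ Finset.sum_le_sum hle)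
  have heq := (Finset.sum_eq_sum_iff_of_le hle).1 (hobj.trans hsum.symm)
  have h01 : ∀ i, x i = 0 ∨ x i = 1 := by
    intro i
    by_contra! h
    have h1 := hFlt (x i) ⟨lt_of_le_of_ne (hx i).1 h.1.symm, lt_of_le_of_ne (hx i).2 h.2⟩
    have h2 := mul_lt_mul_of_pos_left h1 (hw i)
    exact h2.ne (heq i (Finset.mem_univ i))
  refine ⟨h01, hsum, Finset.univ.filter (fun i => x i = 1), by simp, ?_⟩
  rw [← hsum, Finset.sum_filter]
  refine Finset.sum_congr rfl fun i _ => ?_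
  rcases h01 i with h | h <;> simp [h]
end

section
/- Assume additionally that the children sets σ i are pairwise disjoint and every node j ≠ 0 lies in σ i for exactly one i (so σ encodes a tree on Fin n rooted at node 0), that w i > 0 and c i > 0 for all i, and that 0 < B < ∑ i, c i. Then the dual objective z(α) = B * α + λ 0 α is convex on ℝ, and there exists α* > 0 such that z α* ≤ z α for every α ≥ 0; that is, the dual of the uniform-distribution tree fortification problem attains its minimum over [0,∞) at a strictly positive, finite value of α. -/
/-- When `σ` encodes a tree rooted at node 0 (children sets pairwise
disjoint, every nonroot node a child of exactly one node), all weights and costs are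
positive, and `0 < B < ∑ c i`, the dual objective `z(α) = B·α + λ₀(α)` is convex and
attains its minimum over `[0,∞)` at a strictly positive finite `α*`. -/
theorem dual_objective_min_positive
    (n : ℕ) (hn : 1 ≤ n) (σ : Fin n → Finset (Fin n))
    (hσ : ∀ i : Fin n, ∀ j ∈ σ i, i < j)
    (hdisj : ∀ i j : Fin n, i ≠ j → Disjoint (σ i) (σ j))
    (htree : ∀ j : Fin n, j ≠ ⟨0, hn⟩ → ∃! i : Fin n, j ∈ σ i)
    (w c : Fin n → ℝ) (hw : ∀ i, 0 < w i) (hc : ∀ i, 0 < c i)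
    (B : ℝ) (hB0 : 0 < B) (hBc : B < ∑ i, c i)
    (lam : Fin n → ℝ → ℝ)
    (hlam : ∀ i α, lam i α = max ((∑ j ∈ σ i, lam j α) + w i - c i * α) 0) :
    ConvexOn ℝ Set.univ (fun α => B * α + lam ⟨0, hn⟩ α) ∧
    ∃ αstar : ℝ, 0 < αstar ∧
      ∀ α : ℝ, 0 ≤ α →
        B * αstar + lam ⟨0, hn⟩ αstar ≤ B * α + lam ⟨0, hn⟩ α := by
  have hconv : ∀ i, ConvexOn ℝ Set.univ (lam i) := by
    intro i
    induction i using WellFoundedGT.induction with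
    | ind i ih =>
      have h1 : ConvexOn ℝ Set.univ (fun α => ∑ j ∈ σ i, lam j α) := by
        refine ⟨convex_univ, ?_⟩
        intro x _ y _ a b ha hb hab
        simp only [smul_eq_mul, Finset.mul_sum]
        rw [← Finset.sum_add_distrib]
        exact Finset.sum_le_sum fun j hj =>
          (ih j (hσ i j hj)).2 (Set.mem_univ x) (Set.mem_univ y) ha hb hab
      refine ⟨convex_univ, ?_⟩
      intro x hx y hy a b ha hb hab
      have h2 := h1.2 hx hy ha hb hab
      simp only [smul_eq_mul] at h2 ⊢
      have hx1 : (∑ j ∈ σ i, lam j x) + w i - c i * x ≤ lam i x := by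
        rw [hlam i x]; exact le_max_left _ _
      have hy1 : (∑ j ∈ σ i, lam j y) + w i - c i * y ≤ lam i y := by
        rw [hlam i y]; exact le_max_left _ _
      have hx0 : 0 ≤ lam i x := by rw [hlam i x]; exact le_max_right _ _
      have hy0 : 0 ≤ lam i y := by rw [hlam i y]; exact le_max_right _ _
      rw [hlam i (a * x + b * y)]
      refine max_le ?_ (by positivity)
      have e1 := mul_le_mul_of_nonneg_left hx1 ha
      have e2 := mul_le_mul_of_nonneg_left hy1 hb
      have e3 : w i = a * w i + b * w i := by rw [← add_mul, hab, one_mul]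
      nlinarith
  have hcont : ∀ i, Continuous (lam i) := by
    intro i
    induction i using WellFoundedGT.induction with
    | ind i ih =>
      have : lam i = fun α => max ((∑ j ∈ σ i, lam j α) + w i - c i * α) 0 :=
        funext (hlam i)
      rw [this]
      have h1 : Continuous (fun α => ∑ j ∈ σ i, lam j α) :=
        continuous_finsetSum _ fun j hj => ih j (hσ i j hj)
      fun_prop
  have hnn : ∀ i α, 0 ≤ lam i α := fun i α => by rw [hlam i α]; exact le_max_right _ _
  obtain ⟨ε, hε, hεi⟩ : ∃ ε : ℝ, 0 < ε ∧ ∀ i, c i * ε ≤ w i := by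
    haveI : Nonempty (Fin n) := ⟨⟨0, hn⟩⟩
    obtain ⟨k, hk⟩ := Finite.exists_min (fun i => w i / c i)
    refine ⟨w k / c k, div_pos (hw k) (hc k), fun i => ?_⟩
    have := (le_div_iff₀ (hc i)).1 (hk i)
    linarith
  have hcover : Finset.univ.biUnion σ = Finset.univ.erase ⟨0, hn⟩ := by
    ext j
    simp only [Finset.mem_biUnion, Finset.mem_univ, true_and, Finset.mem_erase, and_true]
    constructor
    · rintro ⟨i, hi⟩ rfl
      exact absurd (hσ i _ hi) (by simp [Fin.lt_def])
    · intro hj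
      exact (htree j hj).exists
  have hlin : ∀ α, (∀ i, c i * α ≤ w i) →
      lam ⟨0, hn⟩ α = ∑ i, w i - (∑ i, c i) * α := by
    intro α hα
    have h1 : ∀ i, lam i α = (∑ j ∈ σ i, lam j α) + w i - c i * α := by
      intro i
      rw [hlam i α]
      refine max_eq_left ?_
      have := Finset.sum_nonneg (fun j (_ : j ∈ σ i) => hnn j α)
      linarith [hα i]
    have h2 : ∑ i, lam i α = ∑ i, ((∑ j ∈ σ i, lam j α) + w i - c i * α) :=
      Finset.sum_congr rfl fun i _ => h1 i
    rw [Finset.sum_sub_distrib, Finset.sum_add_distrib, ← Finset.sum_biUnion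
      (fun i _ j _ hij => hdisj i j hij), hcover, ← Finset.sum_mul] at h2
    have h3 := Finset.add_sum_erase Finset.univ (fun i => lam i α)
      (Finset.mem_univ (⟨0, hn⟩ : Fin n))
    linarith
  have hz0 := hlin 0 (fun i => by simpa using (hw i).le)
  have hzε := hlin ε hεi
  have hlt : B * ε + lam ⟨0, hn⟩ ε < lam ⟨0, hn⟩ 0 := by
    rw [hz0, hzε]; nlinarith
  refine ⟨((LinearMap.mul ℝ ℝ B).convexOn convex_univ).add (hconv _), ?_⟩
  set M := max (lam ⟨0, hn⟩ 0 / B) ε with hM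
  obtain ⟨a, ha, hmin⟩ := (isCompact_Icc (a := (0 : ℝ)) (b := M)).exists_isMinOn
    ⟨ε, hε.le, le_max_right _ _⟩
    (f := fun α => B * α + lam ⟨0, hn⟩ α)
    (by have := hcont ⟨0, hn⟩; fun_prop)
  have hmin' : ∀ x ∈ Set.Icc 0 M, B * a + lam ⟨0, hn⟩ a ≤ B * x + lam ⟨0, hn⟩ x :=
    fun x hx => hmin hx
  have haε := hmin' ε ⟨hε.le, le_max_right _ _⟩
  refine ⟨a, lt_of_le_of_ne ha.1 ?_, ?_⟩
  · rintro rfl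
    linarith
  · intro x hx
    rcases le_total x M with h | h
    · exact hmin' x ⟨hx, h⟩
    · have h1 := (div_le_iff₀ hB0).1 ((le_max_left _ _).trans h)
      linarith [hnn ⟨0, hn⟩ x]
end

section
/- Fix α ∈ ℝ. Call μ : Fin n → ℝ dual-feasible (for this α) if μ i ≥ 0 and μ i ≥ ∑_{j ∈ σ i} μ j + w i − c i * α for every i. Then the function i ↦ λ i α is dual-feasible, and every dual-feasible μ satisfies μ i ≥ λ i α for all i. Hence λ 0 α equals the minimum of μ 0 over all dual-feasible μ, justifying the recursive substitution used to eliminate the dual variables without loss of optimality. -/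
/-- For a fixed dual multiplier `α`, the recursively defined function
`i ↦ λ i α` is dual-feasible, is a componentwise lower bound for every dual-feasible
`μ`, and hence `λ 0 α` is the minimum of `μ 0` over all dual-feasible `μ`. -/
theorem dual_lambda_is_min
    (n : ℕ) (hn : 1 ≤ n) (σ : Fin n → Finset (Fin n))
    (hσ : ∀ i : Fin n, ∀ j ∈ σ i, i < j)
    (w c : Fin n → ℝ) (hc : ∀ i, 0 ≤ c i)
    (lam : Fin n → ℝ → ℝ)
    (hlam : ∀ i α, lam i α = max ((∑ j ∈ σ i, lam j α) + w i - c i * α) 0)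
    (α : ℝ) :
    let DualFeasible : (Fin n → ℝ) → Prop := fun μ =>
      ∀ i : Fin n, 0 ≤ μ i ∧ (∑ j ∈ σ i, μ j) + w i - c i * α ≤ μ i
    DualFeasible (fun i => lam i α) ∧
    (∀ μ : Fin n → ℝ, DualFeasible μ → ∀ i, lam i α ≤ μ i) ∧
    IsLeast {v : ℝ | ∃ μ : Fin n → ℝ, DualFeasible μ ∧ μ ⟨0, hn⟩ = v}
      (lam ⟨0, hn⟩ α) := by
  intro DualFeasible
  have h1 : DualFeasible (fun i => lam i α) := by
    intro i
    constructor
    · change 0 ≤ lam i α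
      rw [hlam]
      exact le_max_right _ _
    · change _ ≤ lam i α
      rw [hlam i]
      exact le_max_left _ _
  have h2 : ∀ μ : Fin n → ℝ, DualFeasible μ → ∀ i, lam i α ≤ μ i := by
    intro μ hμ i
    induction i using WellFoundedGT.induction with
    | ind i ih =>
      rw [hlam]
      refine max_le ?_ (hμ i).1
      have hs : ∑ j ∈ σ i, lam j α ≤ ∑ j ∈ σ i, μ j :=
        Finset.sum_le_sum fun j hj => ih j (hσ i j hj)
      have := (hμ i).2
      linarith
  refine ⟨h1, h2, ⟨_, h1, rfl⟩, ?_⟩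
  rintro v ⟨μ, hμ, rfl⟩
  exact h2 μ hμ _
end

section
/- Under the stated assumptions on F, β, and ỹ, the function F̃ is concave on [0,1] and satisfies F̃ y ≥ F y for every y ∈ [0,1]; that is, F̃ is a concave majorant of the S-shaped CDF F on [0,1]. -/
/-- The function `F̃`, equal to the ray `(F ỹ / ỹ)·y` on `[0, ỹ]` and
to `F` on `[ỹ, 1]`, is a concave majorant of the S-shaped CDF `F` on `[0,1]`. -/
theorem upper_concave_envelope_is_concave_majorant
    (F : ℝ → ℝ) (β ytil d : ℝ)
    (hβ : β ∈ Set.Icc (0 : ℝ) 1)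
    (hFcont : ContinuousOn F (Set.Icc 0 1)) (hF0 : F 0 = 0)
    (hFmono : MonotoneOn F (Set.Icc 0 1))
    (hFconv : ConvexOn ℝ (Set.Icc 0 β) F)
    (hFconc : ConcaveOn ℝ (Set.Icc β 1) F)
    (hyt : ytil ∈ Set.Icc β 1) (hyt0 : 0 < ytil)
    (hder : HasDerivAt F d ytil) (htan : F ytil = ytil * d) :
    let Ftil : ℝ → ℝ := fun y => if y ≤ ytil then (F ytil / ytil) * y else F y
    ConcaveOn ℝ (Set.Icc 0 1) Ftil ∧
    ∀ y ∈ Set.Icc (0 : ℝ) 1, F y ≤ Ftil y := by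
  intro Ftil
  have hd : F ytil / ytil = d := by
    rw [htan]; field_simp
  obtain ⟨hβ0, hβ1⟩ := hβ
  obtain ⟨hy1, hy2⟩ := hyt
  -- tangent line inequality on the concave part
  have htl : ∀ y ∈ Set.Icc β 1, F y ≤ d * y := by
    intro y hy
    rcases lt_trichotomy y ytil with h | h | h
    · have := hFconc.le_slope_of_hasDerivAt hy ⟨hy1, hy2⟩ h hder
      rw [slope_def_field, le_div_iff₀ (by linarith)] at this
      nlinarith
    · subst h; linarith
    · have := hFconc.slope_le_of_hasDerivAt ⟨hy1, hy2⟩ hy h hder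
      rw [slope_def_field, div_le_iff₀ (by linarith)] at this
      nlinarith
  have hmaj : ∀ y ∈ Set.Icc (0 : ℝ) 1, F y ≤ d * y := by
    intro y hy
    by_cases h : β ≤ y
    · exact htl y ⟨h, hy.2⟩
    · push Not at h
      have hβp : 0 < β := lt_of_le_of_lt hy.1 h
      have h1 := htl β ⟨le_rfl, hβ1⟩
      have hr : y / β ≤ 1 := by rw [div_le_one hβp]; exact h.le
      have hr0 : 0 ≤ y / β := div_nonneg hy.1 hβ0
      have h2 := hFconv.2 (show (0 : ℝ) ∈ Set.Icc 0 β from ⟨le_rfl, hβ0⟩)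
        (show β ∈ Set.Icc 0 β from ⟨hβ0, le_rfl⟩)
        (show 0 ≤ 1 - y / β by linarith) hr0 (by ring)
      simp only [smul_eq_mul, mul_zero, zero_add, hF0] at h2
      have h3 : y / β * β = y := by field_simp
      rw [h3] at h2
      have h4 := mul_le_mul_of_nonneg_left h1 hr0
      have h5 : y / β * (d * β) = d * y := by rw [← h3]; field_simp
      linarith
  have hlow : ∀ y, y ≤ ytil → Ftil y = d * y := by
    intro y hy
    simp only [Ftil, if_pos hy, hd]
  have hhigh : ∀ y, ytil ≤ y → Ftil y = F y := by
    intro y hy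
    rcases hy.eq_or_lt with h | h
    · subst h; rw [hlow _ le_rfl, htan, mul_comm]
    · simp only [Ftil, if_neg (not_le.mpr h)]
  have hub : ∀ y ∈ Set.Icc (0 : ℝ) 1, Ftil y ≤ d * y := by
    intro y hy
    rcases le_total y ytil with h | h
    · rw [hlow y h]
    · rw [hhigh y h]; exact hmaj y hy
  refine ⟨LinearOrder.concaveOn_of_lt (convex_Icc 0 1) ?_, ?_⟩
  · intro x hx y hy hxy a b ha hb hab
    simp only [smul_eq_mul]
    have hux := hub x hx
    have huy := hub y hy
    have hb1 : b = 1 - a := by linarith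
    rcases le_total (a * x + b * y) ytil with hm | hm
    · rw [hlow _ hm]
      have e1 := mul_le_mul_of_nonneg_left hux ha.le
      have e2 := mul_le_mul_of_nonneg_left huy hb.le
      linarith
    · have hyy : ytil < y := by
        by_contra hcon
        push Not at hcon
        have e1 : a * x < a * y := mul_lt_mul_of_pos_left hxy ha
        have e2 : a * y + b * y = y := by rw [← add_mul, hab, one_mul]
        linarith
      rw [hhigh _ hm, hhigh y hyy.le]
      rcases le_total ytil x with hxt | hxt
      · rw [hhigh x hxt]
        exact hFconc.2 ⟨by linarith, hx.2⟩ ⟨by linarith, hy.2⟩ ha.le hb.le hab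
      · rw [hlow x hxt]
        have hp : 0 < y - ytil := by linarith
        obtain ⟨t, ht⟩ : ∃ t, t = (a * x + b * y - ytil) / (y - ytil) := ⟨_, rfl⟩
        have htm : t * (y - ytil) = a * x + b * y - ytil := by
          rw [ht]; field_simp
        have ht0 : 0 ≤ t := by rw [ht]; exact div_nonneg (by linarith) hp.le
        have htb : t ≤ b := by
          rw [ht, div_le_iff₀ hp]
          have := mul_le_mul_of_nonneg_left hxt ha.le
          subst hb1; linarith
        have h2 := hFconc.2 (show ytil ∈ Set.Icc β 1 from ⟨hy1, hy2⟩)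
          (show y ∈ Set.Icc β 1 from ⟨by linarith, hy.2⟩)
          (show 0 ≤ 1 - t by linarith) ht0 (by ring)
        simp only [smul_eq_mul] at h2
        have h3 : (1 - t) * ytil + t * y = a * x + b * y := by linarith
        rw [h3, htan] at h2
        have hg := hmaj y hy
        have h4 : 0 ≤ (b - t) * (d * y - F y) :=
          mul_nonneg (by linarith) (by linarith)
        have h5 : d * ((1 - t) * ytil + t * y) = d * (a * x + b * y) := by rw [h3]
        linarith
  · intro y hy
    rcases le_total y ytil with h | h
    · rw [hlow y h]; exact hmaj y hy
    · rw [hhigh y h]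
end

section
/- Under the stated assumptions on F, β, and ỹ, if g : ℝ → ℝ is concave on [0,1] and satisfies g y ≥ F y for all y ∈ [0,1], then g y ≥ F̃ y for all y ∈ [0,1]; that is, F̃ is the smallest concave majorant (upper concave envelope) of F on [0,1]. -/
/-- `F̃` is the smallest concave majorant of `F` on `[0,1]`: any
concave function `g` on `[0,1]` dominating `F` also dominates `F̃`. -/
theorem upper_concave_envelope_is_smallest
    (F : ℝ → ℝ) (β ytil d : ℝ)
    (hβ : β ∈ Set.Icc (0 : ℝ) 1)
    (hFcont : ContinuousOn F (Set.Icc 0 1)) (hF0 : F 0 = 0)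
    (hFmono : MonotoneOn F (Set.Icc 0 1))
    (hFconv : ConvexOn ℝ (Set.Icc 0 β) F)
    (hFconc : ConcaveOn ℝ (Set.Icc β 1) F)
    (hyt : ytil ∈ Set.Icc β 1) (hyt0 : 0 < ytil)
    (hder : HasDerivAt F d ytil) (htan : F ytil = ytil * d) :
    let Ftil : ℝ → ℝ := fun y => if y ≤ ytil then (F ytil / ytil) * y else F y
    ∀ g : ℝ → ℝ, ConcaveOn ℝ (Set.Icc 0 1) g →
      (∀ y ∈ Set.Icc (0 : ℝ) 1, F y ≤ g y) →
      ∀ y ∈ Set.Icc (0 : ℝ) 1, Ftil y ≤ g y := by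
  intro Ftil g hg hFg y hy
  change (if y ≤ ytil then (F ytil / ytil) * y else F y) ≤ g y
  split_ifs with h
  · have h0 : (0 : ℝ) ∈ Set.Icc (0 : ℝ) 1 := by simp
    have h1 : ytil ∈ Set.Icc (0 : ℝ) 1 := ⟨hyt0.le, hyt.2⟩
    have ht0 : 0 ≤ y / ytil := div_nonneg hy.1 hyt0.le
    have ht1 : y / ytil ≤ 1 := (div_le_one hyt0).2 h
    have key := hg.2 h0 h1 (sub_nonneg.2 ht1) ht0 (by ring)
    have e : y / ytil * ytil = y := div_mul_cancel₀ y hyt0.ne'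
    simp only [smul_eq_mul, mul_zero, zero_add, e] at key
    have a := mul_nonneg (sub_nonneg.2 ht1) (hF0 ▸ hFg 0 h0)
    have b := mul_le_mul_of_nonneg_left (hFg ytil h1) ht0
    have c : F ytil / ytil * y = y / ytil * F ytil := by ring
    linarith
  · exact hFg y hy
end

section
/- Let β, Λ, C∩ ∈ ℝ and C∪ ≥ 0, and define g x = C∩ * x − C∪ * Real.sqrt ((x − β)² − Λ). Then: (i) for every x with (x − β)² > Λ, the second derivative of h(x) = −Real.sqrt ((x − β)² − Λ) at x equals Λ / ((x − β)² − Λ)^{3/2}; (ii) if Λ ≥ 0 then g is convex on the interval {x : x − β > Real.sqrt Λ}; (iii) if Λ ≤ 0 then g is concave on ℝ. Consequently, for a normal severity distribution the reduced KKT equation g(x∩) = B − C₁ − C∪ β has at most two solutions on its domain. -/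
/-- For `g x = C∩·x − C∪·√((x−β)² − Λ)`: the second derivative of
`h x = −√((x−β)² − Λ)` equals `Λ / ((x−β)² − Λ)^(3/2)` wherever `(x−β)² > Λ`; `g` is
convex on `{x : x − β > √Λ}` when `Λ ≥ 0` and concave on `ℝ` when `Λ ≤ 0`. -/
theorem normal_kkt_convexity
    (β Λ Ci Cu : ℝ) (hCu : 0 ≤ Cu) :
    let h : ℝ → ℝ := fun x => -Real.sqrt ((x - β) ^ 2 - Λ)
    let g : ℝ → ℝ := fun x => Ci * x - Cu * Real.sqrt ((x - β) ^ 2 - Λ)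
    (∀ x : ℝ, Λ < (x - β) ^ 2 →
      deriv (deriv h) x = Λ / ((x - β) ^ 2 - Λ) ^ ((3 : ℝ) / 2)) ∧
    (0 ≤ Λ → ConvexOn ℝ {x : ℝ | Real.sqrt Λ < x - β} g) ∧
    (Λ ≤ 0 → ConcaveOn ℝ Set.univ g) := by
  intro h g
  refine ⟨?_, ?_, ?_⟩
  · intro x hx
    have h1 : ∀ y : ℝ, Λ < (y - β) ^ 2 →
        HasDerivAt (fun x => Real.sqrt ((x - β) ^ 2 - Λ))
          ((y - β) / Real.sqrt ((y - β) ^ 2 - Λ)) y := by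
      intro y hy
      have hp : HasDerivAt (fun x : ℝ => (x - β) ^ 2 - Λ) (2 * (y - β)) y := by
        have := (((hasDerivAt_id y).sub_const β).pow 2).sub_const Λ
        simpa using this
      have := hp.sqrt (sub_pos.2 hy).ne'
      convert this using 1
      rw [mul_div_mul_left _ _ two_ne_zero]
    have hev : deriv h =ᶠ[nhds x] fun y => -((y - β) / Real.sqrt ((y - β) ^ 2 - Λ)) := by
      have hc : Continuous (fun y : ℝ => (y - β) ^ 2) := by fun_prop
      filter_upwards [(isOpen_lt continuous_const hc).mem_nhds hx] with y hy
      exact (h1 y hy).neg.deriv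
    rw [hev.deriv_eq]
    have hpos : 0 < (x - β) ^ 2 - Λ := by linarith
    have hs : 0 < Real.sqrt ((x - β) ^ 2 - Λ) := Real.sqrt_pos.2 hpos
    have h2 := ((((hasDerivAt_id x).sub_const β).div (h1 x hx) hs.ne').neg).deriv
    have h3 : ((x - β) ^ 2 - Λ) ^ ((3 : ℝ) / 2) = Real.sqrt ((x - β) ^ 2 - Λ) ^ 3 := by
      generalize (x - β) ^ 2 - Λ = t at hpos
      rw [Real.sqrt_eq_rpow, ← Real.rpow_natCast, ← Real.rpow_mul hpos.le]
      norm_num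
    rw [h3]
    refine Eq.trans h2 ?_
    have hsq := Real.sq_sqrt hpos.le
    simp only [id]
    generalize Real.sqrt ((x - β) ^ 2 - Λ) = s at *
    field_simp
    linarith
  · intro hL
    have hconv : Convex ℝ {x : ℝ | Real.sqrt Λ < x - β} := by
      have : {x : ℝ | Real.sqrt Λ < x - β} = Set.Ioi (Real.sqrt Λ + β) := by
        ext x
        simp [lt_sub_iff_add_lt]
      rw [this]
      exact convex_Ioi _
    refine ⟨hconv, ?_⟩
    intro x hx y hy a b ha hb hab
    simp only [Set.mem_setOf_eq] at hx hy
    have h0 := Real.sqrt_nonneg Λ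
    have hq := Real.sq_sqrt hL
    have hu : 0 ≤ (x - β) ^ 2 - Λ := by nlinarith
    have hv : 0 ≤ (y - β) ^ 2 - Λ := by nlinarith
    have huv : 0 ≤ (x - β) * (y - β) - Λ := by nlinarith
    have key : Real.sqrt ((x - β) ^ 2 - Λ) * Real.sqrt ((y - β) ^ 2 - Λ)
        ≤ (x - β) * (y - β) - Λ := by
      rw [← Real.sqrt_mul hu]
      apply Real.sqrt_le_iff.2 ⟨huv, ?_⟩
      nlinarith [mul_nonneg hL (sq_nonneg (x - y))]
    have main : a * Real.sqrt ((x - β) ^ 2 - Λ) + b * Real.sqrt ((y - β) ^ 2 - Λ)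
        ≤ Real.sqrt ((a * x + b * y - β) ^ 2 - Λ) := by
      apply Real.le_sqrt_of_sq_le
      have e : (a * x + b * y - β) = a * (x - β) + b * (y - β) := by
        linear_combination β * hab
      have e2 : Λ = (a + b) ^ 2 * Λ := by rw [hab]; ring
      have k2 := mul_le_mul_of_nonneg_left key (mul_nonneg ha hb)
      have e3 := congrArg (a ^ 2 * ·) (Real.sq_sqrt hu)
      have e4 := congrArg (b ^ 2 * ·) (Real.sq_sqrt hv)
      rw [e]
      linarith
    simp only [g, smul_eq_mul]
    nlinarith [mul_le_mul_of_nonneg_left main hCu]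
  · intro hL
    refine ⟨convex_univ, ?_⟩
    intro x _ y _ a b ha hb hab
    have hu : 0 ≤ (x - β) ^ 2 - Λ := by nlinarith [sq_nonneg (x - β)]
    have hv : 0 ≤ (y - β) ^ 2 - Λ := by nlinarith [sq_nonneg (y - β)]
    have key : (x - β) * (y - β) - Λ
        ≤ Real.sqrt ((x - β) ^ 2 - Λ) * Real.sqrt ((y - β) ^ 2 - Λ) := by
      rw [← Real.sqrt_mul hu]
      apply Real.le_sqrt_of_sq_le
      nlinarith [mul_nonneg (neg_nonneg.2 hL) (sq_nonneg (x - y))]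
    have main : Real.sqrt ((a * x + b * y - β) ^ 2 - Λ)
        ≤ a * Real.sqrt ((x - β) ^ 2 - Λ) + b * Real.sqrt ((y - β) ^ 2 - Λ) := by
      apply Real.sqrt_le_iff.2 ⟨by positivity, ?_⟩
      have e : (a * x + b * y - β) = a * (x - β) + b * (y - β) := by
        linear_combination β * hab
      have e2 : Λ = (a + b) ^ 2 * Λ := by rw [hab]; ring
      have k2 := mul_le_mul_of_nonneg_left key (mul_nonneg ha hb)
      have e3 := congrArg (a ^ 2 * ·) (Real.sq_sqrt hu)
      have e4 := congrArg (b ^ 2 * ·) (Real.sq_sqrt hv)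
      rw [e]
      linarith
    simp only [g, smul_eq_mul]
    nlinarith [mul_le_mul_of_nonneg_left main hCu]
end
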